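/- arXiv:1810.01784 — 2 statements merged into one kernel-verified Lean document; each statement's English description precedes it below -/
import Mathlib

section
/- Let D = (V,E) be a nonempty, nontrivial, simple digraph on n ≥ 2 nodes with Laplacian matrix L. Then for every pair (S1,S2) of nonempty, disjoint subsets of V, max(R(S1), R(S2)) = max( max_{i∈{1,...,n}} L_i σ(S1), max_{j∈{1,...,n}} L_j σ(S2) ). -/
/-- The in-neighbor set `N_j = {i : (i,j) ∈ E}` of node `j` in the digraph with
edge relation `E` (where `E i j` means there is a directed edge from `i` to `j`). -/
def inNbrs {n : ℕ} (E : Fin n → Fin n → Prop) [DecidableRel E] (j : Fin n) : Finset (Fin n) :=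
  Finset.univ.filter (fun i => E i j)

/-- A subset `S` is `r`-reachable if some `i ∈ S` has at least `r` in-neighbors outside `S`. -/
def rReachable {n : ℕ} (E : Fin n → Fin n → Prop) [DecidableRel E]
    (S : Finset (Fin n)) (r : ℕ) : Prop :=
  ∃ i ∈ S, r ≤ ((inNbrs E i) \ S).card

/-- A digraph is `r`-robust if for every pair of nonempty disjoint subsets, at least
one of them is `r`-reachable. -/
def rRobust {n : ℕ} (E : Fin n → Fin n → Prop) [DecidableRel E] (r : ℕ) : Prop :=
  ∀ S1 S2 : Finset (Fin n), S1.Nonempty → S2.Nonempty → Disjoint S1 S2 →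
    rReachable E S1 r ∨ rReachable E S2 r

/-- The reachability function `R(S) = max_{i ∈ S} |N_i \ S|` (with `R(∅) = 0`). -/
def reach {n : ℕ} (E : Fin n → Fin n → Prop) [DecidableRel E] (S : Finset (Fin n)) : ℕ :=
  S.sup (fun i => ((inNbrs E i) \ S).card)

/-- `r_max(D)`: the maximum integer `r` for which the digraph is `r`-robust. -/
noncomputable def rMax {n : ℕ} (E : Fin n → Fin n → Prop) [DecidableRel E] : ℕ :=
  sSup {r : ℕ | rRobust E r}

/-- The graph Laplacian: `L j j = |N_j|`, `L j i = -1` if `i ∈ N_j`, and `0` otherwise. -/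
def Lap {n : ℕ} (E : Fin n → Fin n → Prop) [DecidableRel E] : Matrix (Fin n) (Fin n) ℤ :=
  fun j i => if i = j then ((inNbrs E j).card : ℤ) else if i ∈ inNbrs E j then -1 else 0

/-- The indicator vector `σ(S) ∈ {0,1}^n` of a subset `S`. -/
def indVec {n : ℕ} (S : Finset (Fin n)) : Fin n → ℤ :=
  fun j => if j ∈ S then 1 else 0

/-- On `S`, the entry `L_j σ(S)` counts the in-neighbors of `j` outside `S`. -/
lemma Lap_mulVec_indVec_of_mem {n : ℕ} (E : Fin n → Fin n → Prop) [DecidableRel E]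
    (hirr : ∀ i, ¬ E i i) {S : Finset (Fin n)} {j : Fin n} (hj : j ∈ S) :
    (Lap E).mulVec (indVec S) j = ((inNbrs E j \ S).card : ℤ) := by
  have hjj : j ∉ inNbrs E j := by simp [inNbrs, hirr]
  have hterm : ∀ i, Lap E j i * indVec S i =
      (if i = j then ((inNbrs E j).card : ℤ) else 0) - if i ∈ inNbrs E j ∩ S then 1 else 0 := by
    intro i
    simp only [Lap, indVec, Finset.mem_inter]
    by_cases hij : i = j
    · subst hij
      simp [hj, hjj]
    · by_cases hi : i ∈ inNbrs E j <;> by_cases hS : i ∈ S <;> simp [hij, hi, hS]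
  simp only [Matrix.mulVec, dotProduct, hterm, Finset.sum_sub_distrib, Finset.sum_ite_eq',
    Finset.mem_univ, if_true, Finset.sum_boole, Finset.filter_univ_mem]
  have hcard := Finset.card_sdiff_add_card_inter (inNbrs E j) S
  omega

/-- Off `S`, the entry `L_j σ(S)` is nonpositive. -/
lemma Lap_mulVec_indVec_nonpos_of_notMem {n : ℕ} (E : Fin n → Fin n → Prop) [DecidableRel E]
    {S : Finset (Fin n)} {j : Fin n} (hj : j ∉ S) :
    (Lap E).mulVec (indVec S) j ≤ 0 := by
  rw [Matrix.mulVec, dotProduct]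
  refine Finset.sum_nonpos fun i _ => ?_
  by_cases hij : i = j
  · simp [indVec, hij, hj]
  · by_cases hi : i ∈ inNbrs E j <;> by_cases hS : i ∈ S <;> simp [Lap, indVec, hij, hi, hS]

/-- For nonempty `S`, `R(S) = max_j L_j σ(S)`. -/
lemma reach_eq_sup'_Lap_mulVec_indVec {n : ℕ} (E : Fin n → Fin n → Prop) [DecidableRel E]
    (hirr : ∀ i, ¬ E i i) {S : Finset (Fin n)} (hS : S.Nonempty)
    (huniv : (Finset.univ : Finset (Fin n)).Nonempty) :
    (reach E S : ℤ) = Finset.univ.sup' huniv (fun j => (Lap E).mulVec (indVec S) j) := by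
  apply le_antisymm
  · obtain ⟨i, hi, hmax⟩ := Finset.exists_mem_eq_sup S hS fun i => (inNbrs E i \ S).card
    rw [reach, hmax, ← Lap_mulVec_indVec_of_mem E hirr hi]
    exact Finset.le_sup' (fun j => (Lap E).mulVec (indVec S) j) (Finset.mem_univ i)
  · refine Finset.sup'_le _ _ fun j _ => ?_
    by_cases hj : j ∈ S
    · rw [Lap_mulVec_indVec_of_mem E hirr hj]
      exact_mod_cast Finset.le_sup (f := fun i => (inNbrs E i \ S).card) hj
    · exact (Lap_mulVec_indVec_nonpos_of_notMem E hj).trans (Int.natCast_nonneg _)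

/-- For every pair of nonempty disjoint subsets `(S1, S2)`,
`max(R(S1), R(S2)) = max(max_i L_i σ(S1), max_j L_j σ(S2))`. -/
theorem max_reach_eq_max_lap {n : ℕ} (hn : 2 ≤ n) (E : Fin n → Fin n → Prop) [DecidableRel E]
    (hirr : ∀ i, ¬ E i i) :
    ∀ S1 S2 : Finset (Fin n), S1.Nonempty → S2.Nonempty → Disjoint S1 S2 →
      ((max (reach E S1) (reach E S2) : ℕ) : ℤ) =
        max
          (Finset.univ.sup'
            (Finset.univ_nonempty_iff.mpr (Fin.pos_iff_nonempty.mp (by omega)))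
            (fun i => (Lap E).mulVec (indVec S1) i))
          (Finset.univ.sup'
            (Finset.univ_nonempty_iff.mpr (Fin.pos_iff_nonempty.mp (by omega)))
            (fun j => (Lap E).mulVec (indVec S2) j)) := by
  intro S1 S2 h1 h2 _
  rw [Nat.cast_max, reach_eq_sup'_Lap_mulVec_indVec E hirr h1,
    reach_eq_sup'_Lap_mulVec_indVec E hirr h2]
end

section
/- Let D = (V,E) be a nonempty, nontrivial, simple digraph on n ≥ 2 nodes with Laplacian matrix L. Then r_max(D) equals the minimum value of t over all t ∈ ℝ and b ∈ ℤ^{2n} satisfying: 0 ≤ t; (writing b = (b1; b2) with b1, b2 ∈ ℤ^n) L b1 ≤ t·1 and L b2 ≤ t·1 componentwise; 0 ≤ b ≤ 1 componentwise; b1 + b2 ≤ 1 componentwise; 1 ≤ 1ᵀb1 ≤ n−1; and 1 ≤ 1ᵀb2 ≤ n−1. Moreover this minimum is attained. -/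
theorem Lap_mulVec_indVec {n : ℕ} (E : Fin n → Fin n → Prop) [DecidableRel E]
    (hirr : ∀ i, ¬ E i i) (S : Finset (Fin n)) (i : Fin n) :
    (Lap E).mulVec (indVec S) i =
      if i ∈ S then ((inNbrs E i \ S).card : ℤ) else -((inNbrs E i ∩ S).card : ℤ) := by
  have hentry : ∀ j, Lap E i j * indVec S j =
      (if j = i then (if i ∈ S then ((inNbrs E i).card : ℤ) else 0) else 0) -
        (if j ∈ inNbrs E i ∩ S then 1 else 0) := by
    intro j
    have hi : i ∉ inNbrs E i := by simp [inNbrs, hirr]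
    unfold Lap indVec
    by_cases hj : j = i
    · subst hj
      simp [hi]
    · by_cases h1 : j ∈ inNbrs E i <;> by_cases h2 : j ∈ S <;> simp [hj, h1, h2]
  have hsum : (Lap E).mulVec (indVec S) i =
      (if i ∈ S then ((inNbrs E i).card : ℤ) else 0) - ((inNbrs E i ∩ S).card : ℤ) := by
    simp only [Matrix.mulVec, dotProduct, hentry, Finset.sum_sub_distrib]
    simp [-Finset.mem_inter]
  have hcard := Finset.card_sdiff_add_card_inter (inNbrs E i) S
  rw [hsum]
  split_ifs <;> omega

theorem Lap_mulVec_indVec_le_iff {n : ℕ} (E : Fin n → Fin n → Prop) [DecidableRel E]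
    (hirr : ∀ i, ¬ E i i) (S : Finset (Fin n)) {t : ℝ} (ht : 0 ≤ t) :
    (∀ i, ((Lap E).mulVec (indVec S) i : ℝ) ≤ t) ↔
      ∀ i ∈ S, ((inNbrs E i \ S).card : ℝ) ≤ t := by
  refine forall_congr' fun i => ?_
  rw [Lap_mulVec_indVec E hirr]
  by_cases hi : i ∈ S
  · simp [hi]
  · simp only [hi, if_false, false_imp_iff, iff_true]
    push_cast
    linarith [Nat.cast_nonneg (α := ℝ) (inNbrs E i ∩ S).card]

theorem sum_indVec {n : ℕ} (S : Finset (Fin n)) : ∑ j, indVec S j = (S.card : ℤ) := by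
  simp [indVec]

theorem eq_indVec_of_mem_zero_one {n : ℕ} {b : Fin n → ℤ} (hb : ∀ j, 0 ≤ b j ∧ b j ≤ 1) :
    b = indVec (Finset.univ.filter fun j => b j = 1) := by
  ext j
  have := hb j
  simp only [indVec, Finset.mem_filter_univ]
  split_ifs <;> omega

theorem rRobust_zero {n : ℕ} (E : Fin n → Fin n → Prop) [DecidableRel E] : rRobust E 0 :=
  fun _ _ h1 _ _ => Or.inl (h1.imp fun _ hi => ⟨hi, Nat.zero_le _⟩)

theorem bddAbove_rRobust {n : ℕ} (hn : 2 ≤ n) (E : Fin n → Fin n → Prop) [DecidableRel E] :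
    BddAbove {r : ℕ | rRobust E r} := by
  refine ⟨n, fun r hr => ?_⟩
  have hle : ∀ S, rReachable E S r → r ≤ n := fun S ⟨i, _, hi⟩ =>
    hi.trans ((Finset.card_le_univ _).trans_eq (Fintype.card_fin n))
  exact (hr {(⟨0, by omega⟩ : Fin n)} {(⟨1, by omega⟩ : Fin n)} (Finset.singleton_nonempty _)
    (Finset.singleton_nonempty _) (by simp [Fin.ext_iff])).elim (hle _) (hle _)

theorem rRobust_rMax {n : ℕ} (hn : 2 ≤ n) (E : Fin n → Fin n → Prop) [DecidableRel E] :
    rRobust E (rMax E) :=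
  Nat.sSup_mem (s := {r : ℕ | rRobust E r}) ⟨0, rRobust_zero E⟩ (bddAbove_rRobust hn E)

theorem not_rRobust_rMax_succ {n : ℕ} (hn : 2 ≤ n) (E : Fin n → Fin n → Prop)
    [DecidableRel E] : ¬ rRobust E (rMax E + 1) := fun h =>
  absurd (le_csSup (bddAbove_rRobust hn E) h) (Nat.not_succ_le_self _)

/-- `r_max(D)` equals the minimum value of `t` over all `t ∈ ℝ` and integer
vectors `b = (b1; b2) ∈ ℤ^{2n}` satisfying `0 ≤ t`, `L b1 ≤ t·1`, `L b2 ≤ t·1`,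
`0 ≤ b ≤ 1`, `b1 + b2 ≤ 1`, `1 ≤ 1ᵀb1 ≤ n−1`, `1 ≤ 1ᵀb2 ≤ n−1`;
moreover this minimum is attained. -/
theorem rMax_eq_min_milp_affine {n : ℕ} (hn : 2 ≤ n) (E : Fin n → Fin n → Prop) [DecidableRel E]
    (hirr : ∀ i, ¬ E i i) :
    IsLeast
      {t : ℝ | 0 ≤ t ∧
        ∃ b1 b2 : Fin n → ℤ,
          (∀ i, ((Lap E).mulVec b1 i : ℝ) ≤ t) ∧
          (∀ i, ((Lap E).mulVec b2 i : ℝ) ≤ t) ∧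
          (∀ j, 0 ≤ b1 j ∧ b1 j ≤ 1) ∧ (∀ j, 0 ≤ b2 j ∧ b2 j ≤ 1) ∧
          (∀ j, b1 j + b2 j ≤ 1) ∧
          1 ≤ ∑ j, b1 j ∧ ∑ j, b1 j ≤ (n : ℤ) - 1 ∧
          1 ≤ ∑ j, b2 j ∧ ∑ j, b2 j ≤ (n : ℤ) - 1}
      ((rMax E : ℝ)) := by
  constructor
  · have h := not_rRobust_rMax_succ hn E
    simp only [rRobust, not_forall, not_or] at h
    obtain ⟨S1, S2, h1, h2, hdis, hS1, hS2⟩ := h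
    have hle : ∀ S, ¬ rReachable E S (rMax E + 1) →
        ∀ i, ((Lap E).mulVec (indVec S) i : ℝ) ≤ rMax E := by
      intro S hS
      rw [Lap_mulVec_indVec_le_iff E hirr S (Nat.cast_nonneg _)]
      intro i hi
      exact_mod_cast Nat.lt_succ_iff.mp (not_le.mp fun hge => hS ⟨i, hi, hge⟩)
    have hbd : ∀ (S : Finset (Fin n)) j, 0 ≤ indVec S j ∧ indVec S j ≤ 1 := by
      intro S j
      unfold indVec
      split_ifs <;> simp
    have hcard : S1.card + S2.card ≤ n := by
      rw [← Finset.card_union_of_disjoint hdis]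
      exact (Finset.card_le_univ _).trans_eq (Fintype.card_fin n)
    have hpos1 := h1.card_pos
    have hpos2 := h2.card_pos
    refine ⟨Nat.cast_nonneg _, indVec S1, indVec S2, hle S1 hS1, hle S2 hS2, hbd S1, hbd S2,
      fun j => ?_, ?_⟩
    · have hj : j ∈ S1 → j ∉ S2 := fun h => Finset.disjoint_left.mp hdis h
      unfold indVec
      split_ifs <;> simp_all
    · simp only [sum_indVec]
      omega
  · rintro t ⟨ht, b1, b2, hL1, hL2, hb1, hb2, hadd, hs1, -, hs2, -⟩
    obtain ⟨S1, rfl⟩ : ∃ S, b1 = indVec S := ⟨_, eq_indVec_of_mem_zero_one hb1⟩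
    obtain ⟨S2, rfl⟩ : ∃ S, b2 = indVec S := ⟨_, eq_indVec_of_mem_zero_one hb2⟩
    rw [sum_indVec] at hs1 hs2
    rw [Lap_mulVec_indVec_le_iff E hirr _ ht] at hL1 hL2
    have hdis : Disjoint S1 S2 := by
      refine Finset.disjoint_left.mpr fun j hj1 hj2 => ?_
      have := hadd j
      simp [indVec, hj1, hj2] at this
    rcases rRobust_rMax hn E S1 S2 (Finset.card_pos.mp (by omega))
      (Finset.card_pos.mp (by omega)) hdis with ⟨i, hi, hr⟩ | ⟨i, hi, hr⟩
    · exact (Nat.cast_le.mpr hr).trans (hL1 i hi)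
    · exact (Nat.cast_le.mpr hr).trans (hL2 i hi)
end
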